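/- For every n ≥ 1, the tree CB(n,4) is friendly to every finite tree with n+3 edges. -/

import Mathlib

open SimpleGraph

/-- `p` does not catch `q` in `G`: they are disjoint and for any two distinct edges of `p`,
the path in `G` between them contains an even number of edges of `q`. -/
def DoesNotCatch {V : Type*} (G : SimpleGraph V) (p q : Set (Sym2 V)) : Prop :=
  p ∩ q = ∅ ∧
    ∀ e ∈ p, ∀ f ∈ p, e ≠ f →
      ∀ (u v : V) (w : G.Walk u v), w.IsPath → u ∈ e → v ∈ f →
        e ∉ w.edges → f ∉ w.edges →
        Even (w.edges.countP (fun x => @decide (x ∈ q) (Classical.propDecidable _)))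

/-- `p` and `q` are unlinked in `G`. -/
def Unlinked {V : Type*} (G : SimpleGraph V) (p q : Set (Sym2 V)) : Prop :=
  DoesNotCatch G p q ∧ DoesNotCatch G q p

/-- Image of a set of edges of `G₁` under a map of edge sets. -/
def edgeImage {V₁ V₂ : Type*} {G₁ : SimpleGraph V₁} {G₂ : SimpleGraph V₂}
    (φ : G₁.edgeSet → G₂.edgeSet) (s : Set (Sym2 V₁)) : Set (Sym2 V₂) :=
  {e₂ | ∃ e₁ : G₁.edgeSet, (e₁ : Sym2 V₁) ∈ s ∧ (φ e₁ : Sym2 V₂) = e₂}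

/-- A bijection of edge sets is friendly if the images of the coboundaries (incidence sets)
of any two distinct vertices at even distance are unlinked. -/
def FriendlyBij {V₁ V₂ : Type*} (G₁ : SimpleGraph V₁) (G₂ : SimpleGraph V₂)
    (φ : G₁.edgeSet ≃ G₂.edgeSet) : Prop :=
  ∀ P Q : V₁, P ≠ Q → Even (G₁.dist P Q) →
    Unlinked G₂ (edgeImage φ (G₁.incidenceSet P)) (edgeImage φ (G₁.incidenceSet Q))

/-- `G₁` is friendly to `G₂`. -/
def Friendly {V₁ V₂ : Type*} (G₁ : SimpleGraph V₁) (G₂ : SimpleGraph V₂) : Prop :=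
  ∃ φ : G₁.edgeSet ≃ G₂.edgeSet, FriendlyBij G₁ G₂ φ

/-- The tree `CB n₁ n₂`: two adjacent centers `0` and `1` of degrees `n₁` and `n₂`,
all other vertices being leaves. -/
def CB (n₁ n₂ : ℕ) : SimpleGraph (Fin (n₁ + n₂)) :=
  SimpleGraph.fromRel (fun a b =>
    (a.val = 0 ∧ b.val = 1) ∨ (a.val = 0 ∧ 2 ≤ b.val ∧ b.val ≤ n₁) ∨
    (a.val = 1 ∧ n₁ + 1 ≤ b.val))

/-- `par` and `d` are the parent and the depth function of the tree `G` rooted at `r`. The value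
`par r` is irrelevant. -/
structure IsRooting {V : Type*} (G : SimpleGraph V) (r : V) (par : V → V) (d : V → ℕ) : Prop where
  adj_iff : ∀ x y, G.Adj x y ↔ (x ≠ r ∧ par x = y) ∨ (y ≠ r ∧ par y = x)
  depth_par : ∀ x, x ≠ r → d (par x) + 1 = d x

/-- A set of edges is path-convex if every path whose end vertices are covered by the set
runs inside the set. -/
def PathConvex {V : Type*} (G : SimpleGraph V) (T : Set (Sym2 V)) : Prop :=
  ∀ (u v : V) (w : G.Walk u v), w.IsPath → (∃ e ∈ T, u ∈ e) → (∃ f ∈ T, v ∈ f) →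
    ∀ x ∈ w.edges, x ∈ T

theorem PathConvex.doesNotCatch {V : Type*} {G : SimpleGraph V} {p q : Set (Sym2 V)}
    (hp : PathConvex G p) (hpq : p ∩ q = ∅) : DoesNotCatch G p q := by
  refine ⟨hpq, fun e he f hf _ u v w hw hu hv _ _ ↦ ?_⟩
  have h := hp u v w hw ⟨e, he, hu⟩ ⟨f, hf, hv⟩
  have h0 : w.edges.countP (fun x => @decide (x ∈ q) (Classical.propDecidable _)) = 0 := by
    rw [List.countP_eq_zero]
    intro x hx hxq
    have : x ∈ p ∩ q := ⟨h x hx, by simpa using hxq⟩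
    simp [hpq] at this
  rw [h0]
  exact Even.zero

theorem doesNotCatch_of_subsingleton {V : Type*} {G : SimpleGraph V} {p q : Set (Sym2 V)}
    (hp : p.Subsingleton) (hpq : p ∩ q = ∅) : DoesNotCatch G p q :=
  ⟨hpq, fun _ he _ hf hef ↦ absurd (hp he hf) hef⟩

/-- Every tree can be rooted at any of its vertices. -/
theorem SimpleGraph.IsTree.exists_isRooting {V : Type*} {G : SimpleGraph V} (hT : G.IsTree)
    (r : V) : ∃ par d, IsRooting G r par d := by
  choose p hp hlen using fun x ↦ hT.connected.exists_path_of_dist x r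
  have hadj : ∀ x, x ≠ r → G.Adj x (p x).snd := fun x hx ↦
    (p x).adj_snd (Walk.not_nil_of_ne hx)
  have hpar : ∀ x y, G.Adj x y → G.dist x r = G.dist y r + 1 → x ≠ r ∧ (p x).snd = y := by
    intro x y h hd
    refine ⟨by rintro rfl; simp at hd, ?_⟩
    have hw : (Walk.cons h (p y)).IsPath :=
      Walk.isPath_of_length_eq_dist _ (by simp [hlen, hd])
    have := (hT.isAcyclic.subsingleton_path x r).elim ⟨p x, hp x⟩ ⟨_, hw⟩
    rw [Subtype.mk.injEq] at this
    rw [this, Walk.snd_cons]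
  have hdist : ∀ x y, G.Adj x y → G.dist x r = G.dist y r + 1 ∨ G.dist y r = G.dist x r + 1 := by
    intro x y h
    have := hT.dist_eq_dist_add_one_of_adj r h
    simpa [dist_comm] using this
  refine ⟨fun x ↦ (p x).snd, fun x ↦ G.dist x r, fun x y ↦ ⟨fun h ↦ ?_, ?_⟩, fun x hx ↦ ?_⟩
  · rcases hdist x y h with h1 | h1
    · exact .inl (hpar x y h h1)
    · exact .inr (hpar y x h.symm h1)
  · rintro (⟨hx, rfl⟩ | ⟨hy, rfl⟩)
    · exact hadj x hx
    · exact (hadj y hy).symm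
  · have h1 := (p x).length_tail_add_one (Walk.not_nil_of_ne hx)
    have h2 := dist_le (p x).tail
    have h3 := hlen x
    have := hdist x _ (hadj x hx)
    omega

namespace IsRooting

variable {V : Type*} {G : SimpleGraph V} {r : V} {par : V → V} {d : V → ℕ}

theorem adj_par (h : IsRooting G r par d) {x : V} (hx : x ≠ r) : G.Adj x (par x) :=
  (h.adj_iff _ _).2 (.inl ⟨hx, rfl⟩)

/-- The edges of a rooted tree correspond to its non-root vertices. -/
noncomputable def edgeEquiv (h : IsRooting G r par d) : {x // x ≠ r} ≃ G.edgeSet :=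
  Equiv.ofBijective (fun x ↦ ⟨s(x.1, par x.1), h.adj_par x.2⟩) <| by
    refine ⟨?_, ?_⟩
    · rintro ⟨x, hx⟩ ⟨y, hy⟩ hxy
      rw [Subtype.mk.injEq]
      rcases Sym2.eq_iff.1 (congrArg Subtype.val hxy) with ⟨rfl, _⟩ | ⟨h1, h2⟩
      · rfl
      · replace h1 : x = par y := h1
        replace h2 : par x = y := h2
        have hdx := h.depth_par x hx
        have hdy := h.depth_par y hy
        rw [h2] at hdx
        rw [← h1] at hdy
        omega
    · rintro ⟨e, he⟩
      induction e using Sym2.ind with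
      | _ x y =>
        rcases (h.adj_iff x y).1 he with ⟨hx, rfl⟩ | ⟨hy, rfl⟩
        · exact ⟨⟨x, hx⟩, rfl⟩
        · exact ⟨⟨y, hy⟩, Subtype.ext Sym2.eq_swap⟩

@[simp] theorem coe_edgeEquiv (h : IsRooting G r par d) (x : {x // x ≠ r}) :
    (h.edgeEquiv x : Sym2 V) = s(x.1, par x.1) := rfl

theorem exists_walk_to_top (h : IsRooting G r par d) {S : Set V} {t : V}
    (hS : ∀ x ∈ S, x ≠ r ∧ (par x ∈ S ∨ par x = t)) (u : V) (hu : u ∈ S ∨ u = t) :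
    ∃ w : G.Walk u t, ∀ e ∈ w.edges, e ∈ (fun x ↦ s(x, par x)) '' S := by
  induction hk : d u using Nat.strong_induction_on generalizing u with
  | _ k ih =>
    rcases hu with hu | rfl
    · obtain ⟨hr, hp⟩ := hS u hu
      have hd := h.depth_par u hr
      obtain ⟨w, hw⟩ := ih (d (par u)) (by omega) (par u) hp rfl
      refine ⟨.cons (h.adj_par hr) w, fun e he ↦ ?_⟩
      rw [Walk.edges_cons, List.mem_cons] at he
      rcases he with rfl | he
      · exact ⟨u, hu, rfl⟩
      · exact hw e he
    · exact ⟨.nil, by simp⟩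

theorem pathConvex (h : IsRooting G r par d) (hG : G.IsAcyclic) {S : Set V} {t : V}
    (hS : ∀ x ∈ S, x ≠ r ∧ (par x ∈ S ∨ par x = t)) :
    PathConvex G ((fun x ↦ s(x, par x)) '' S) := by
  classical
  have key : ∀ u, (∃ e ∈ (fun x ↦ s(x, par x)) '' S, u ∈ e) → u ∈ S ∨ u = t := by
    rintro u ⟨_, ⟨x, hx, rfl⟩, hu⟩
    rcases Sym2.mem_iff.1 hu with rfl | rfl
    · exact .inl hx
    · exact (hS x hx).2
  intro u v w hw hu hv x hx
  obtain ⟨w₁, h₁⟩ := h.exists_walk_to_top hS u (key u hu)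
  obtain ⟨w₂, h₂⟩ := h.exists_walk_to_top hS v (key v hv)
  have huniq := (hG.subsingleton_path u v).elim ⟨w, hw⟩ (w₁.append w₂.reverse).toPath
  have hw' : w = (w₁.append w₂.reverse).toPath := congrArg Subtype.val huniq
  rw [hw'] at hx
  have hx' := Walk.edges_toPath_subset_edges _ hx
  simp only [Walk.edges_append, Walk.edges_reverse, List.mem_append, List.mem_reverse] at hx'
  exact hx'.elim (h₁ x) (h₂ x)

end IsRooting

/-- In a rooted tree with at least five vertices, three vertices `a`, `b`, `c` can be cut off so
that the rest stays connected, and there are two further vertices, `m` and `t`, which together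
with `a`, `b`, `c` induce a subtree with top `t`. -/
theorem exists_cut_triple {V : Type*} [Fintype V] {r : V} {par : V → V}
    {d : V → ℕ} (hd : ∀ x, x ≠ r → d (par x) + 1 = d x) (hV : 5 ≤ Fintype.card V) :
    ∃ a b c m t : V, [a, b, c, m, r].Nodup ∧
      (∀ x, x ≠ r → par x ∈ [a, b, c] → x ∈ [a, b, c]) ∧
      (∀ x ∈ [a, b, c, m], par x ∈ [a, b, c, m, t]) := by
  classical
  have hex : ∀ s : List V, s.length < 5 → ∃ x, x ∉ s := by
    intro s hs
    by_contra! hc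
    have h1 : Fintype.card V ≤ s.toFinset.card := by
      rw [← Finset.card_univ]
      exact Finset.card_le_card fun x _ ↦ by simpa using hc x
    have := s.toFinset_card_le
    omega
  -- it suffices to find `a`, `b`, `c` that hang below a vertex `p`
  have reduce : ∀ a b c p : V, [a, b, c, p].Nodup → r ∉ [a, b, c] →
      (∀ x, x ≠ r → par x ∈ [a, b, c] → x ∈ [a, b, c]) →
      (∀ x ∈ [a, b, c], par x ∈ [a, b, c, p]) →
      ∃ a b c m t : V, [a, b, c, m, r].Nodup ∧
      (∀ x, x ≠ r → par x ∈ [a, b, c] → x ∈ [a, b, c]) ∧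
      (∀ x ∈ [a, b, c, m], par x ∈ [a, b, c, m, t]) := by
    intro a b c p hnd hr hdown hup
    by_cases hp : p = r
    · obtain ⟨z, hz, hmin⟩ : ∃ z ∈ ({x | x ∉ [a, b, c, r]} : Finset V),
          ∀ y ∈ ({x | x ∉ [a, b, c, r]} : Finset V), d z ≤ d y := by
        apply Finset.exists_min_image
        obtain ⟨x, hx⟩ := hex [a, b, c, r] (by simp)
        exact ⟨x, by simpa using hx⟩
      have hzr : z ≠ r := by grind
      have hdz := hd z hzr
      have hpz : par z = r := by
        by_contra hne
        have h1 := hdown z hzr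
        have h2 := hmin (par z) (by grind)
        omega
      exact ⟨a, b, c, z, r, by grind, hdown, by grind⟩
    · exact ⟨a, b, c, p, par p, by grind, hdown, by grind⟩
  obtain ⟨v, -, hmax⟩ := Finset.exists_max_image (Finset.univ : Finset V) d
    ((Fintype.card_pos_iff.1 (by omega) : Nonempty V).elim fun v ↦ ⟨v, Finset.mem_univ v⟩)
  replace hmax := fun x ↦ hmax x (Finset.mem_univ x)
  have hleaf : ∀ x, d x = d v → ∀ y, y ≠ r → par y ≠ x := by
    intro x hx y hy hyx
    have := hd y hy
    have := hmax y
    grind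
  have hroot : ∀ k x, d x = k → d r ≤ d x := by
    intro k
    induction k with
    | zero =>
      intro x hx
      by_cases hxr : x = r
      · rw [hxr]
      · have := hd x hxr
        omega
    | succ k ih =>
      intro x hx
      by_cases hxr : x = r
      · rw [hxr]
      · have := hd x hxr
        have := ih (par x) (by omega)
        omega
  have htop : ∀ x, d x ≤ d r → x = r := by
    intro x hx
    by_contra hxr
    have := hd x hxr
    have := hroot _ (par x) rfl
    omega
  have hvr : v ≠ r := by
    rintro rfl
    obtain ⟨x, hx⟩ := hex [v] (by simp)
    exact hx (by simpa using htop x (hmax x))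
  have hdv := hd v hvr
  have hsib : ∀ x, x ≠ r → par x = par v → ∀ y, y ≠ r → par y ≠ x := by
    intro x hx hxv
    have := hd x hx
    exact hleaf x (by grind)
  have hsib' : ∀ x, x ≠ r → par x = par v → x ≠ par v := by
    intro x hx hxv h
    have := hd x hx
    grind
  by_cases hv1 : par v = r
  · have hall : ∀ x, x ≠ r → par x = r := by
      intro x hx
      have := hd x hx
      have := hmax x
      exact htop _ (by grind)
    obtain ⟨b, hb⟩ := hex [v, r] (by simp)
    obtain ⟨c, hc⟩ := hex [v, r, b] (by simp)
    exact reduce v b c r (by grind) (by grind) (by grind) (by grind)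
  have hdv1 := hd _ hv1
  by_cases h2 : ∃ b, b ≠ r ∧ b ≠ v ∧ par b = par v
  · obtain ⟨b, hbr, hbv, hb⟩ := h2
    by_cases h3 : ∃ c, c ≠ r ∧ c ≠ v ∧ c ≠ b ∧ par c = par v
    · obtain ⟨c, hcr, hcv, hcb, hc⟩ := h3
      exact reduce v b c (par v) (by grind) (by grind) (by grind) (by grind)
    · exact reduce v b (par v) (par (par v)) (by grind) (by grind) (by grind) (by grind)
  by_cases h3 : ∃ u, u ≠ r ∧ u ≠ par v ∧ par u = par (par v)
  · obtain ⟨u, hur, huv, hu⟩ := h3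
    have hdu := hd u hur
    by_cases h4 : ∃ w, w ≠ r ∧ par w = u
    · obtain ⟨w, hwr, hw⟩ := h4
      have hdw := hd w hwr
      have hwleaf := hleaf w (by grind)
      exact ⟨v, par v, w, u, par (par v), by grind, by grind, by simp [hu, hw]⟩
    · exact reduce v (par v) u (par (par v)) (by grind) (by grind) (by grind) (by grind)
  · have hv2 : par (par v) ≠ r := by
      intro hv2
      obtain ⟨x, hx⟩ := hex [v, par v, r] (by simp)
      have hxr : x ≠ r := by grind
      have := hd x hxr
      have := hmax x
      by_cases hpx : par x = r
      · grind
      · have := hd _ hpx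
        have := htop (par (par x)) (by grind)
        grind
    have hdv2 := hd _ hv2
    exact reduce v (par v) (par (par v)) (par (par (par v))) (by grind) (by grind) (by grind)
      (by grind)

/-- The tree `CB n 4`, rooted at the center `1`. -/
theorem isRooting_CB (n : ℕ) (hn : 1 ≤ n) :
    IsRooting (CB n 4) ⟨1, by omega⟩
      (fun x ↦ if 2 ≤ x.val ∧ x.val ≤ n then ⟨0, by omega⟩ else ⟨1, by omega⟩)
      (fun x ↦ if x.val = 1 then 0 else if 2 ≤ x.val ∧ x.val ≤ n then 2 else 1) where
  adj_iff x y := by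
    simp only [CB, fromRel_adj, ne_eq, Fin.ext_iff]
    split_ifs <;> dsimp only <;> omega
  depth_par x hx := by
    simp only [ne_eq, Fin.ext_iff] at hx
    split_ifs <;> simp_all

theorem edgeImage_edgeEquiv {V₁ V₂ : Type*} {G₁ : SimpleGraph V₁} {G₂ : SimpleGraph V₂}
    {r₁ : V₁} {par₁ : V₁ → V₁} {d₁ : V₁ → ℕ} {r₂ : V₂} {par₂ : V₂ → V₂} {d₂ : V₂ → ℕ}
    (h₁ : IsRooting G₁ r₁ par₁ d₁) (h₂ : IsRooting G₂ r₂ par₂ d₂) (g : V₁ ≃ V₂)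
    (hg : ∀ x, x ≠ r₁ ↔ g x ≠ r₂) (P : V₁) :
    edgeImage (h₁.edgeEquiv.symm.trans ((g.subtypeEquiv hg).trans h₂.edgeEquiv))
      (G₁.incidenceSet P) =
      (fun y ↦ s(y, par₂ y)) '' (g '' {x | x ≠ r₁ ∧ (P = x ∨ P = par₁ x)}) := by
  ext e
  constructor
  · rintro ⟨e₁, he, rfl⟩
    obtain ⟨x, rfl⟩ := h₁.edgeEquiv.surjective e₁
    refine ⟨g x, ⟨x, ⟨x.2, ?_⟩, rfl⟩, ?_⟩
    · simpa using Sym2.mem_iff.1 he.2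
    · simp
  · rintro ⟨_, ⟨x, ⟨hx, hP⟩, rfl⟩, rfl⟩
    refine ⟨h₁.edgeEquiv ⟨x, hx⟩, ⟨Subtype.coe_prop _, Sym2.mem_iff.2 hP⟩, ?_⟩
    simp

theorem edgeImage_inter_eq_empty {V₁ V₂ : Type*} {G₁ : SimpleGraph V₁} {G₂ : SimpleGraph V₂}
    (φ : G₁.edgeSet ≃ G₂.edgeSet) {P Q : V₁} (hPQ : P ≠ Q) (h : ¬ G₁.Adj P Q) :
    edgeImage φ (G₁.incidenceSet P) ∩ edgeImage φ (G₁.incidenceSet Q) = ∅ := by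
  rw [Set.eq_empty_iff_forall_notMem]
  rintro _ ⟨⟨e, he, rfl⟩, ⟨f, hf, hfe⟩⟩
  obtain rfl := φ.injective (Subtype.ext hfe)
  exact h (G₁.adj_of_mem_incidenceSet hPQ he hf)

/-- For every `n ≥ 1`, the tree `CB n 4` is friendly to every finite tree with
`n + 3` edges. -/
theorem cb_n_4_friendly {V : Type*} [Fintype V] [DecidableEq V]
    (G : SimpleGraph V) [DecidableRel G.Adj] (hT : G.IsTree)
    (n : ℕ) (hn : 1 ≤ n) (hE : G.edgeFinset.card = n + 3) :
    Friendly (CB n 4) G := by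
  have hV : Fintype.card V = n + 4 := by
    rw [← hT.card_edgeFinset, hE]
  have : Nonempty V := Fintype.card_pos_iff.1 (by omega)
  obtain ⟨par, d, hr⟩ := hT.exists_isRooting (Classical.arbitrary V)
  generalize Classical.arbitrary V = r at hr
  obtain ⟨a, b, c, m, t, hnd, hdown, hup⟩ := exists_cut_triple hr.depth_par (by omega)
  have hCB := isRooting_CB n hn
  -- place `m`, `r`, `a`, `b`, `c` at the right vertices of `CB n 4`
  obtain ⟨g, hg⟩ : ∃ g : Fin (n + 4) ≃ V, g ⟨0, by omega⟩ = m ∧ g ⟨1, by omega⟩ = r ∧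
      g ⟨n + 1, by omega⟩ = a ∧ g ⟨n + 2, by omega⟩ = b ∧ g ⟨n + 3, by omega⟩ = c := by
    let f : Fin (n + 4) → V := fun x ↦ if x.val = 0 then m else if x.val = 1 then r else
      if x.val = n + 1 then a else if x.val = n + 2 then b else c
    obtain ⟨g, hg⟩ := Finset.exists_equiv_extend_of_card_eq (t := (Finset.univ : Finset V))
      (s := {⟨0, by omega⟩, ⟨1, by omega⟩, ⟨n + 1, by omega⟩, ⟨n + 2, by omega⟩,
        ⟨n + 3, by omega⟩}) (f := f) (by simp [hV]) (Finset.subset_univ _) (by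
        intro x hx y hy hxy
        simp only [Finset.coe_insert, Finset.coe_singleton, Set.mem_insert_iff,
          Set.mem_singleton_iff, Fin.ext_iff, f] at hx hy hxy ⊢
        simp only [List.nodup_cons, List.mem_cons, not_or] at hnd
        clear hdown hup
        split_ifs at hxy <;> grind)
    refine ⟨g.trans (Equiv.subtypeUnivEquiv Finset.mem_univ), ?_⟩
    simp only [Finset.mem_insert, Finset.mem_singleton, forall_eq_or_imp, forall_eq] at hg
    simpa [f, show n ≠ 0 by omega] using hg
  obtain ⟨hg0, hg1, hga, hgb, hgc⟩ := hg
  have hgr : ∀ x, x ≠ (⟨1, by omega⟩ : Fin (n + 4)) ↔ g x ≠ r := by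
    intro x
    rw [← hg1, g.injective.ne_iff]
  refine ⟨hCB.edgeEquiv.symm.trans ((g.subtypeEquiv hgr).trans hr.edgeEquiv), ?_⟩
  have hconv : ∀ P, PathConvex G (edgeImage (hCB.edgeEquiv.symm.trans
      ((g.subtypeEquiv hgr).trans hr.edgeEquiv)) ((CB n 4).incidenceSet P)) ∨
      (edgeImage (hCB.edgeEquiv.symm.trans
      ((g.subtypeEquiv hgr).trans hr.edgeEquiv)) ((CB n 4).incidenceSet P)).Subsingleton := by
    intro P
    rw [edgeImage_edgeEquiv]
    by_cases hP0 : P.val = 0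
    · left
      apply hr.pathConvex hT.isAcyclic (t := r)
      have hS : ∀ y, y ≠ r → y ∉ [a, b, c] → y ∈ g '' {x : Fin (n + 4) | x ≠ ⟨1, by omega⟩ ∧
          (P = x ∨ P = if 2 ≤ x.val ∧ x.val ≤ n then ⟨0, by omega⟩ else ⟨1, by omega⟩)} := by
        intro y hyr hy
        obtain ⟨x, rfl⟩ := g.surjective y
        simp only [← hg1, ← hga, ← hgb, ← hgc, List.mem_cons, g.injective.eq_iff, ne_eq,
          Fin.ext_iff, List.not_mem_nil] at hyr hy
        refine ⟨x, ⟨by simpa [Fin.ext_iff] using hyr, ?_⟩, rfl⟩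
        rw [Fin.ext_iff, Fin.ext_iff, apply_ite Fin.val]
        grind
      rintro _ ⟨x, ⟨hx1, hx⟩, rfl⟩
      have hxr := (hgr x).1 hx1
      have hxn : g x ∉ [a, b, c] := by
        simp only [← hga, ← hgb, ← hgc, List.mem_cons, g.injective.eq_iff, Fin.ext_iff,
          List.not_mem_nil]
        rw [Fin.ext_iff, Fin.ext_iff, apply_ite Fin.val] at hx
        grind
      refine ⟨hxr, or_iff_not_imp_right.2 fun hpr ↦ hS _ hpr fun h ↦ hxn (hdown _ hxr h)⟩
    by_cases hP1 : P.val = 1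
    · left
      apply hr.pathConvex hT.isAcyclic (t := t)
      have hS : g '' {x : Fin (n + 4) | x ≠ ⟨1, by omega⟩ ∧
          (P = x ∨ P = if 2 ≤ x.val ∧ x.val ≤ n then ⟨0, by omega⟩ else ⟨1, by omega⟩)} =
          {y | y ∈ [a, b, c, m]} := by
        ext y
        obtain ⟨x, rfl⟩ := g.surjective y
        simp only [g.injective.mem_set_image, Set.mem_ofPred_eq, ← hg0, ← hga, ← hgb, ← hgc,
          List.mem_cons, g.injective.eq_iff, ne_eq, Fin.ext_iff, apply_ite Fin.val,
          List.not_mem_nil]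
        grind
      rw [hS]
      intro y hy
      refine ⟨by grind, ?_⟩
      have := hup y hy
      grind
    · right
      refine (Set.Subsingleton.image (Set.Subsingleton.image ?_ _) _)
      apply Set.subsingleton_singleton.anti (t := {P})
      rintro x ⟨-, rfl | hx⟩
      · rfl
      · split_ifs at hx <;> simp [hx] at hP0 hP1
  have hcatch : ∀ P Q, P ≠ Q → ¬ (CB n 4).Adj P Q → DoesNotCatch G _ _ := fun P Q hPQ h ↦
    (hconv P).elim (fun hP ↦ hP.doesNotCatch (edgeImage_inter_eq_empty _ hPQ h))
      fun hP ↦ doesNotCatch_of_subsingleton hP (edgeImage_inter_eq_empty _ hPQ h)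
  intro P Q hPQ hdist
  have hnadj : ¬ (CB n 4).Adj P Q := by
    rw [← dist_eq_one_iff_adj]
    intro h
    simp [h] at hdist
  exact ⟨hcatch P Q hPQ hnadj, hcatch Q P hPQ.symm fun h ↦ hnadj h.symm⟩
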